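/- arXiv:1607.01308 — 6 statements merged into one kernel-verified Lean document; each statement's English description precedes it below -/
import Mathlib

section
/- For every k ≠ 0 the matrix F(k) is symmetric positive definite, and det F(k) = ρ k² (coth|k| + ρ); in particular F(k) is invertible. -/
open Matrix

/-- The matrix `F(k)` from the dispersion relation. Here `coth t = cosh t / sinh t`. -/
noncomputable def Fmat (ρ k : ℝ) : Matrix (Fin 2) (Fin 2) ℝ :=
  !![|k| + ρ * |k| * (Real.cosh |k| / Real.sinh |k|), -(ρ * |k| / Real.sinh |k|);
     -(ρ * |k| / Real.sinh |k|), ρ * |k| * (Real.cosh |k| / Real.sinh |k|)]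

/-- A real symmetric `2 × 2` matrix whose leading principal minors are positive is positive
definite. -/
theorem Matrix.posDef_fin_two_of_pos {a b d : ℝ} (ha : 0 < a) (hdet : 0 < a * d - b * b) :
    (!![a, b; b, d] : Matrix (Fin 2) (Fin 2) ℝ).PosDef := by
  refine Matrix.PosDef.of_dotProduct_mulVec_pos ?_ fun x hx => ?_
  · ext i j
    fin_cases i <;> fin_cases j <;> simp
  · simp only [dotProduct, mulVec, Fin.sum_univ_two, Pi.star_apply, star_trivial, of_apply,
      cons_val_zero, cons_val_one, cons_val', cons_val_fin_one]
    refine pos_of_mul_pos_right (a := a) ?_ ha.le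
    have key : a * (x 0 * (a * x 0 + b * x 1) + x 1 * (b * x 0 + d * x 1)) =
        (a * x 0 + b * x 1) ^ 2 + (a * d - b * b) * x 1 ^ 2 := by ring
    rw [key]
    by_cases h1 : x 1 = 0
    · have h0 : x 0 ≠ 0 := fun h0 => hx (by ext i; fin_cases i <;> simp [h0, h1])
      have : 0 < (a * x 0) ^ 2 := by positivity
      simpa only [h1, mul_zero, add_zero, ne_eq, OfNat.ofNat_ne_zero, not_false_eq_true,
        zero_pow] using this
    · positivity

/-- The determinant of `F(k)`. -/
theorem det_Fmat (ρ : ℝ) {k : ℝ} (hk : k ≠ 0) :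
    (Fmat ρ k).det = ρ * k ^ 2 * (Real.cosh |k| / Real.sinh |k| + ρ) := by
  have hs : Real.sinh |k| ≠ 0 := (Real.sinh_pos_iff.2 (abs_pos.2 hk)).ne'
  rw [Fmat, det_fin_two_of, ← sq_abs k]
  field_simp
  linear_combination ρ ^ 2 * Real.cosh_sq |k|

/-- For every `k ≠ 0` the matrix `F(k)` is symmetric positive definite and
`det F(k) = ρ k² (coth|k| + ρ)`; in particular `F(k)` is invertible. -/
theorem Fmat_posDef_det (ρ βl βu : ℝ) (hρ : ρ ∈ Set.Ioo (0:ℝ) 1) (hβl : 0 < βl)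
    (hβu : 0 < βu) (k : ℝ) (hk : k ≠ 0) :
    (Fmat ρ k).IsSymm ∧ (Fmat ρ k).PosDef ∧
      (Fmat ρ k).det = ρ * k ^ 2 * (Real.cosh |k| / Real.sinh |k| + ρ) ∧
      IsUnit (Fmat ρ k) := by
  have hx : 0 < |k| := abs_pos.2 hk
  have hs : 0 < Real.sinh |k| := Real.sinh_pos_iff.2 hx
  have hc : 0 < Real.cosh |k| := Real.cosh_pos _
  have hρ0 : 0 < ρ := hρ.1
  have hdet := det_Fmat ρ hk
  have hpos : 0 < (Fmat ρ k).det := by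
    rw [hdet]
    positivity
  have hF : (Fmat ρ k).PosDef := by
    rw [Fmat, det_fin_two_of] at hpos
    exact Matrix.posDef_fin_two_of_pos (by positivity) hpos
  refine ⟨?_, hF, hdet, hF.isUnit⟩
  ext i j
  fin_cases i <;> fin_cases j <;> simp [Fmat]
end

section
/- As k → 0 with k ≠ 0 one has |k|·λ_+(k) → 1 and (λ_−(k) − (1 − ρ))/|k| → −ρ(1 − ρ); in particular λ_+(k) → +∞ and λ_−(k) → 1 − ρ as k → 0. -/
open Filter

/-- The discriminant `D(k)`. -/
noncomputable def Dfun (ρ βl βu k : ℝ) : ℝ :=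
  ((1 - ρ + βl * k ^ 2) - (Real.tanh |k| + ρ) * (1 + βu * k ^ 2)) ^ 2
    + (4 * ρ / Real.cosh |k| ^ 2) * (1 - ρ + βl * k ^ 2) * (1 + βu * k ^ 2)

/-- The slow branch `λ₋(k)` of the dispersion relation. -/
noncomputable def lamM (ρ βl βu k : ℝ) : ℝ :=
  ((1 - ρ + βl * k ^ 2) + (1 + βu * k ^ 2) * (Real.tanh |k| + ρ) - Real.sqrt (Dfun ρ βl βu k))
    / (2 * |k| * (1 + ρ * Real.tanh |k|))

/-- The fast branch `λ₊(k)` of the dispersion relation. -/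
noncomputable def lamP (ρ βl βu k : ℝ) : ℝ :=
  ((1 - ρ + βl * k ^ 2) + (1 + βu * k ^ 2) * (Real.tanh |k| + ρ) + Real.sqrt (Dfun ρ βl βu k))
    / (2 * |k| * (1 + ρ * Real.tanh |k|))

open Topology

theorem Real.one_div_cosh_sq (x : ℝ) : 1 / Real.cosh x ^ 2 = 1 - Real.tanh x ^ 2 := by
  have h := (Real.cosh_pos x).ne'
  rw [Real.tanh_eq_sinh_div_cosh]
  field_simp
  linarith [Real.cosh_sq x]

theorem Real.hasDerivAt_tanh_one_sub_sq (x : ℝ) :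
    HasDerivAt Real.tanh (1 - Real.tanh x ^ 2) x := by
  have h := (Real.cosh_pos x).ne'
  have hd := (Real.hasDerivAt_sinh x).div (Real.hasDerivAt_cosh x) h
  have hfun : Real.tanh = Real.sinh / Real.cosh := funext Real.tanh_eq_sinh_div_cosh
  rw [← hfun] at hd
  refine hd.congr_deriv ?_
  rw [Real.tanh_eq_sinh_div_cosh]
  field_simp

theorem Real.hasDerivAt_tanh_zero : HasDerivAt Real.tanh 1 0 := by
  simpa using Real.hasDerivAt_tanh_one_sub_sq 0

theorem Real.tendsto_tanh_div_self : Tendsto (fun x : ℝ => Real.tanh x / x) (𝓝[>] 0) (𝓝 1) := by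
  simpa [div_eq_inv_mul] using Real.hasDerivAt_tanh_zero.tendsto_slope_zero_right

theorem Real.tendsto_tanh_sub_self_div_sq :
    Tendsto (fun x : ℝ => (Real.tanh x - x) / x ^ 2) (𝓝[>] 0) (𝓝 0) := by
  have ht : Tendsto Real.tanh (𝓝[>] 0) (𝓝 0) := by
    simpa using Real.hasDerivAt_tanh_zero.continuousAt.tendsto.mono_left nhdsWithin_le_nhds
  have hid : Tendsto (fun x : ℝ => x) (𝓝[>] 0) (𝓝 0) := tendsto_id.mono_left nhdsWithin_le_nhds
  refine HasDerivAt.lhopital_zero_nhdsGT (f' := fun x => 1 - Real.tanh x ^ 2 - 1)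
    (g' := fun x => 2 * x) ?_ ?_ ?_ ?_ ?_ ?_
  · exact .of_forall fun x => (Real.hasDerivAt_tanh_one_sub_sq x).sub (hasDerivAt_id x)
  · exact .of_forall fun x => by simpa using hasDerivAt_pow 2 x
  · filter_upwards [self_mem_nhdsWithin] with x hx
    exact mul_ne_zero two_ne_zero (ne_of_gt hx)
  · simpa using ht.sub hid
  · simpa using hid.pow 2
  · have h := (ht.mul Real.tendsto_tanh_div_self).mul_const (-(1 / 2) : ℝ)
    rw [zero_mul, zero_mul] at h
    refine h.congr fun x => ?_
    rcases eq_or_ne x 0 with rfl | hx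
    · simp
    · field_simp
      ring

/-- The sum `S` for which the branches at `|k| = x` are
`(S ± √D) / (2 * x * (1 + ρ * tanh x))`. -/
noncomputable def branchSum (ρ βl βu x : ℝ) : ℝ :=
  (1 - ρ + βl * x ^ 2) + (1 + βu * x ^ 2) * (Real.tanh x + ρ)

/-- The discriminant as a function of `x = |k|`, in a form that is smooth at `0`. -/
noncomputable def smoothDisc (ρ βl βu x : ℝ) : ℝ :=
  branchSum ρ βl βu x ^ 2
    - 4 * (1 - ρ + βl * x ^ 2) * (1 + βu * x ^ 2) * (Real.tanh x * (1 + ρ * Real.tanh x))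

/-- The numerator of the fast branch as a function of `x = |k|`. -/
noncomputable def fastNum (ρ βl βu x : ℝ) : ℝ :=
  branchSum ρ βl βu x + Real.sqrt (smoothDisc ρ βl βu x)

/-- The slow branch at `|k| = x` divided by `tanh x / x`. -/
noncomputable def slowFactor (ρ βl βu x : ℝ) : ℝ :=
  2 * (1 - ρ + βl * x ^ 2) * (1 + βu * x ^ 2) / fastNum ρ βl βu x

theorem Dfun_eq_smoothDisc (ρ βl βu k : ℝ) : Dfun ρ βl βu k = smoothDisc ρ βl βu |k| := by
  rw [Dfun, smoothDisc, branchSum, sq_abs, div_eq_mul_one_div (4 * ρ), Real.one_div_cosh_sq]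
  ring

theorem Dfun_nonneg {ρ βl βu : ℝ} (hρ : ρ ∈ Set.Ioo (0 : ℝ) 1) (hβl : 0 < βl) (hβu : 0 < βu)
    (k : ℝ) : 0 ≤ Dfun ρ βl βu k := by
  have h0 := hρ.1
  have h1 : 0 < 1 - ρ := sub_pos.2 hρ.2
  rw [Dfun]
  positivity

theorem lamP_eq (ρ βl βu k : ℝ) :
    lamP ρ βl βu k = fastNum ρ βl βu |k| / (2 * |k| * (1 + ρ * Real.tanh |k|)) := by
  rw [lamP, fastNum, Dfun_eq_smoothDisc, branchSum, sq_abs]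

theorem lamM_eq {ρ βl βu : ℝ} (hρ : ρ ∈ Set.Ioo (0 : ℝ) 1) (hβl : 0 < βl) (hβu : 0 < βu)
    {k : ℝ} (hk : k ≠ 0) :
    lamM ρ βl βu k = slowFactor ρ βl βu |k| * (Real.tanh |k| / |k|) := by
  have h0 := hρ.1
  have h1 : 0 < 1 - ρ := sub_pos.2 hρ.2
  have hx : 0 < |k| := abs_pos.2 hk
  have ht : 0 < Real.tanh |k| := by
    rw [Real.tanh_eq_sinh_div_cosh]
    exact div_pos (Real.sinh_pos_iff.2 hx) (Real.cosh_pos _)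
  have hD := Dfun_nonneg hρ hβl hβu k
  rw [Dfun_eq_smoothDisc] at hD
  have hs := Real.sq_sqrt hD
  have hnum : 0 < fastNum ρ βl βu |k| := by
    rw [fastNum, branchSum]
    positivity
  have hM : lamM ρ βl βu k = (branchSum ρ βl βu |k| - √(smoothDisc ρ βl βu |k|))
      / (2 * |k| * (1 + ρ * Real.tanh |k|)) := by
    rw [lamM, Dfun_eq_smoothDisc, branchSum, sq_abs]
  have hden : 0 < 1 + ρ * Real.tanh |k| := by positivity
  rw [hM, slowFactor, div_mul_div_comm, div_eq_div_iff (by positivity) (by positivity)]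
  have hprod : (branchSum ρ βl βu |k| - √(smoothDisc ρ βl βu |k|)) * fastNum ρ βl βu |k|
      = 4 * (1 - ρ + βl * |k| ^ 2) * (1 + βu * |k| ^ 2)
        * (Real.tanh |k| * (1 + ρ * Real.tanh |k|)) := by
    rw [fastNum]
    rw [smoothDisc] at hs ⊢
    linear_combination -hs
  linear_combination |k| * hprod

theorem smoothDisc_zero (ρ βl βu : ℝ) : smoothDisc ρ βl βu 0 = 1 := by
  simp [smoothDisc, branchSum]

theorem fastNum_zero (ρ βl βu : ℝ) : fastNum ρ βl βu 0 = 2 := by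
  rw [fastNum, smoothDisc_zero]
  norm_num [branchSum]

theorem slowFactor_zero (ρ βl βu : ℝ) : slowFactor ρ βl βu 0 = 1 - ρ := by
  rw [slowFactor, fastNum_zero]
  ring

theorem hasDerivAt_const_add_mul_sq_zero (a b : ℝ) :
    HasDerivAt (fun x : ℝ => a + b * x ^ 2) 0 0 := by
  simpa using ((hasDerivAt_pow 2 (0 : ℝ)).const_mul b).const_add a

theorem hasDerivAt_branchSum_zero (ρ βl βu : ℝ) : HasDerivAt (branchSum ρ βl βu) 1 0 := by
  have h := (hasDerivAt_const_add_mul_sq_zero (1 - ρ) βl).add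
    ((hasDerivAt_const_add_mul_sq_zero 1 βu).mul (Real.hasDerivAt_tanh_zero.add_const ρ))
  refine h.congr_deriv ?_
  simp

theorem hasDerivAt_smoothDisc_zero (ρ βl βu : ℝ) :
    HasDerivAt (smoothDisc ρ βl βu) (2 - 4 * (1 - ρ)) 0 := by
  have h := ((hasDerivAt_branchSum_zero ρ βl βu).pow 2).sub
    ((((hasDerivAt_const_add_mul_sq_zero (1 - ρ) βl).const_mul 4).mul
      (hasDerivAt_const_add_mul_sq_zero 1 βu)).mul
      (Real.hasDerivAt_tanh_zero.mul ((Real.hasDerivAt_tanh_zero.const_mul ρ).const_add 1)))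
  refine h.congr_deriv ?_
  simp [branchSum]

theorem hasDerivAt_fastNum_zero (ρ βl βu : ℝ) : HasDerivAt (fastNum ρ βl βu) (2 * ρ) 0 := by
  have h := (hasDerivAt_branchSum_zero ρ βl βu).add
    ((hasDerivAt_smoothDisc_zero ρ βl βu).sqrt (by simp [smoothDisc_zero]))
  refine h.congr_deriv ?_
  rw [smoothDisc_zero, Real.sqrt_one]
  ring

theorem hasDerivAt_slowFactor_zero (ρ βl βu : ℝ) :
    HasDerivAt (slowFactor ρ βl βu) (-(ρ * (1 - ρ))) 0 := by
  have h := (((hasDerivAt_const_add_mul_sq_zero (1 - ρ) βl).const_mul 2).mul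
    (hasDerivAt_const_add_mul_sq_zero 1 βu)).div (hasDerivAt_fastNum_zero ρ βl βu)
    (by simp [fastNum_zero])
  refine h.congr_deriv ?_
  simp [fastNum_zero]
  ring

theorem tendsto_slowFactor_mul_tanh_div_sub (ρ βl βu : ℝ) :
    Tendsto (fun x => (slowFactor ρ βl βu x * (Real.tanh x / x) - (1 - ρ)) / x) (𝓝[>] 0)
      (𝓝 (-(ρ * (1 - ρ)))) := by
  have hs := (hasDerivAt_slowFactor_zero ρ βl βu).tendsto_slope_zero_right
  have h := (hs.mul Real.tendsto_tanh_div_self).add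
    (Real.tendsto_tanh_sub_self_div_sq.const_mul (1 - ρ))
  rw [mul_one, mul_zero, add_zero] at h
  refine h.congr' ?_
  filter_upwards [self_mem_nhdsWithin] with x hx
  have hx0 : x ≠ 0 := ne_of_gt hx
  rw [zero_add, slowFactor_zero, smul_eq_mul]
  field_simp
  ring

/-- As `k → 0` with `k ≠ 0`: `|k|·λ₊(k) → 1` and
`(λ₋(k) − (1 − ρ))/|k| → −ρ(1 − ρ)`; in particular `λ₊(k) → +∞` and `λ₋(k) → 1 − ρ`. -/
theorem lam_asymptotics_at_zero (ρ βl βu : ℝ) (hρ : ρ ∈ Set.Ioo (0:ℝ) 1) (hβl : 0 < βl)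
    (hβu : 0 < βu) :
    Tendsto (fun k : ℝ => |k| * lamP ρ βl βu k) (nhdsWithin 0 {0}ᶜ) (nhds 1) ∧
    Tendsto (fun k : ℝ => (lamM ρ βl βu k - (1 - ρ)) / |k|) (nhdsWithin 0 {0}ᶜ)
      (nhds (-(ρ * (1 - ρ)))) ∧
    Tendsto (fun k : ℝ => lamP ρ βl βu k) (nhdsWithin 0 {0}ᶜ) atTop ∧
    Tendsto (fun k : ℝ => lamM ρ βl βu k) (nhdsWithin 0 {0}ᶜ) (nhds (1 - ρ)) := by
  have hfast : Tendsto (fun k : ℝ => |k| * lamP ρ βl βu k) (𝓝[≠] 0) (𝓝 1) := by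
    have hden : Tendsto (fun x : ℝ => 2 * (1 + ρ * Real.tanh x)) (𝓝 0) (𝓝 2) := by
      simpa using ((Real.hasDerivAt_tanh_zero.continuousAt.tendsto.const_mul ρ).const_add
        1).const_mul 2
    have h := ((hasDerivAt_fastNum_zero ρ βl βu).continuousAt.tendsto.div hden
      two_ne_zero).comp (tendsto_abs_nhdsNE_zero.mono_right nhdsWithin_le_nhds)
    rw [fastNum_zero, div_self two_ne_zero] at h
    refine h.congr' ?_
    filter_upwards [self_mem_nhdsWithin] with k hk
    have hk' : |k| ≠ 0 := abs_ne_zero.2 hk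
    rw [lamP_eq, Function.comp_apply, Pi.div_apply, mul_comm 2 |k|, mul_assoc,
      ← mul_div_assoc, mul_div_mul_left _ _ hk']
  have hslow : Tendsto (fun k : ℝ => (lamM ρ βl βu k - (1 - ρ)) / |k|) (𝓝[≠] 0)
      (𝓝 (-(ρ * (1 - ρ)))) := by
    refine ((tendsto_slowFactor_mul_tanh_div_sub ρ βl βu).comp
      tendsto_abs_nhdsNE_zero).congr' ?_
    filter_upwards [self_mem_nhdsWithin] with k hk
    rw [lamM_eq hρ hβl hβu hk, Function.comp_apply]
  refine ⟨hfast, hslow, ?_, ?_⟩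
  · refine (hfast.pos_mul_atTop one_pos
      (tendsto_inv_nhdsGT_zero.comp tendsto_abs_nhdsNE_zero)).congr' ?_
    filter_upwards [self_mem_nhdsWithin] with k hk
    have hk' : |k| ≠ 0 := abs_ne_zero.2 hk
    rw [Function.comp_apply, mul_comm |k|, mul_inv_cancel_right₀ hk']
  · have h := (hslow.mul (tendsto_abs_nhdsNE_zero.mono_right nhdsWithin_le_nhds)).add_const
      (1 - ρ)
    rw [mul_zero, zero_add] at h
    refine h.congr' ?_
    filter_upwards [self_mem_nhdsWithin] with k hk
    rw [div_mul_cancel₀ _ (abs_ne_zero.2 hk), sub_add_cancel]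
end

section
/- For every k0 > 0, det g(k0) = 0 and there exists a real number a > 0 such that g(k0) applied to the vector (1, −a) is zero; equivalently, (1, −a) is an eigenvector of F(k0)⁻¹P(k0) with eigenvalue λ_−(k0), with strictly positive first component and strictly negative second component. -/
open Matrix

/-- The matrix `P(k)`. -/
noncomputable def Pmat (ρ βl βu k : ℝ) : Matrix (Fin 2) (Fin 2) ℝ :=
  !![1 - ρ + βl * k ^ 2, 0; 0, ρ * (1 + βu * k ^ 2)]

/-- The matrix `g(k) = P(k) − λ₋(k₀) F(k)`. -/
noncomputable def gmat (ρ βl βu k0 k : ℝ) : Matrix (Fin 2) (Fin 2) ℝ :=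
  Pmat ρ βl βu k - lamM ρ βl βu k0 • Fmat ρ k

/-- The smaller root `m` of the quadratic `det (P - m F) = 0`, in terms of `T = tanh k`,
`u = coth k` and `w = 1 / sinh k`, lies in `(0, A / (1 + ρ u))`. -/
lemma smaller_root_bounds {ρ A B T u w r m : ℝ} (hρ : 0 < ρ) (hA : 0 < A) (hB : 0 < B)
    (hT : 0 < T) (hTu : T * u = 1) (hw : 0 < w) (huw : u ^ 2 - w ^ 2 = 1) (hr : 0 < r)
    (hr2 : r ^ 2 = (A - (T + ρ) * B) ^ 2 + 4 * ρ * (1 - T ^ 2) * A * B)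
    (hm : m * (2 * (1 + ρ * T)) = A + B * (T + ρ) - r) :
    0 < m ∧ 0 < A - m * (1 + ρ * u) ∧
      (A - m * (1 + ρ * u)) * (B - m * u) = ρ * (m * w) ^ 2 := by
  have hu : 0 < u := by
    by_contra h
    nlinarith
  have hQ : 0 < 1 + ρ * T := by positivity
  have hrX : r < A + B * (T + ρ) := by
    apply lt_of_pow_lt_pow_left₀ 2 (by positivity)
    have : 0 < 4 * (1 + ρ * T) * A * B * T := by positivity
    linarith
  have hm0 : 0 < m := by
    by_contra h
    nlinarith
  have hq : m ^ 2 * (1 + ρ * T) - m * (A + B * (T + ρ)) + A * B * T = 0 := by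
    have hr' : r = A + B * (T + ρ) - m * (2 * (1 + ρ * T)) := by linarith
    rw [hr'] at hr2
    have : 4 * (1 + ρ * T) * (m ^ 2 * (1 + ρ * T) - m * (A + B * (T + ρ)) + A * B * T) = 0 := by
      linear_combination hr2
    exact (mul_eq_zero.mp this).resolve_left (by positivity)
  have hdet : (A - m * (1 + ρ * u)) * (B - m * u) = ρ * (m * w) ^ 2 := by
    linear_combination u * hq + ρ * m ^ 2 * huw
      - (m ^ 2 * ρ - m * B + A * B) * hTu
  have hsum : (1 + ρ * u) * (B - m * u) + u * (A - m * (1 + ρ * u)) + 2 * m * ρ * w ^ 2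
      = r * u := by
    linear_combination (-u) * hm + (2 * m * ρ - B) * hTu - 2 * m * ρ * huw
  refine ⟨hm0, ?_, hdet⟩
  by_contra! h
  set x := A - m * (1 + ρ * u)
  set y := B - m * u
  have hxy : 0 < x * y := by rw [hdet]; positivity
  have hy : y ≤ 0 := by
    by_contra! hy
    nlinarith [mul_nonpos_of_nonpos_of_nonneg h hy.le]
  have hlt : (1 + ρ * u) * -y + u * -x < 2 * m * ρ * w ^ 2 := by
    have : 0 < r * u := by positivity
    linarith
  have hsq : ((1 + ρ * u) * -y + u * -x) ^ 2 < (2 * m * ρ * w ^ 2) ^ 2 :=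
    pow_lt_pow_left₀ hlt (add_nonneg (mul_nonneg (by positivity) (by linarith))
      (mul_nonneg hu.le (by linarith))) two_ne_zero
  have hdiff : (2 * m * ρ * w ^ 2) ^ 2 + 4 * ρ * (m * w) ^ 2 * (u + ρ)
      = 4 * ((1 + ρ * u) * u) * (x * y) := by
    rw [hdet]
    linear_combination (-4) * ρ ^ 2 * (m * w) ^ 2 * huw
  have : 0 < 4 * ρ * (m * w) ^ 2 * (u + ρ) := by positivity
  linarith [sq_nonneg ((1 + ρ * u) * y - u * x)]

/-- For every `k₀ > 0`, `det g(k₀) = 0` and there is `a > 0` with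
`g(k₀)(1, −a) = 0`; i.e. `(1, −a)` is an eigenvector of `F(k₀)⁻¹P(k₀)` with eigenvalue
`λ₋(k₀)`, with positive first and negative second component. -/
theorem gmat_kernel_vector (ρ βl βu : ℝ) (hρ : ρ ∈ Set.Ioo (0:ℝ) 1) (hβl : 0 < βl)
    (hβu : 0 < βu) (k0 : ℝ) (hk0 : 0 < k0) :
    (gmat ρ βl βu k0 k0).det = 0 ∧
      ∃ a : ℝ, 0 < a ∧ gmat ρ βl βu k0 k0 *ᵥ ![1, -a] = 0 := by
  obtain ⟨hρ0, hρ1⟩ := hρ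
  have hs : 0 < Real.sinh k0 := Real.sinh_pos_iff.mpr hk0
  have hc : 0 < Real.cosh k0 := Real.cosh_pos k0
  have hcs : Real.cosh k0 ^ 2 - Real.sinh k0 ^ 2 = 1 := Real.cosh_sq_sub_sinh_sq k0
  have hT : 0 < Real.tanh k0 := by rw [Real.tanh_eq_sinh_div_cosh]; positivity
  have hA : 0 < 1 - ρ + βl * k0 ^ 2 := by
    have : 0 < βl * k0 ^ 2 := by positivity
    linarith
  have hB : 0 < 1 + βu * k0 ^ 2 := by positivity
  have hD : 0 < Dfun ρ βl βu k0 := by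
    unfold Dfun
    rw [abs_of_pos hk0]
    exact add_pos_of_nonneg_of_pos (sq_nonneg _) (by positivity)
  have hsech : 1 / Real.cosh k0 ^ 2 = 1 - Real.tanh k0 ^ 2 := by
    rw [Real.tanh_eq_sinh_div_cosh]
    field_simp
    linarith
  obtain ⟨hm, hg, hdet⟩ := smaller_root_bounds (u := Real.cosh k0 / Real.sinh k0)
    (w := 1 / Real.sinh k0) (r := √(Dfun ρ βl βu k0)) (m := lamM ρ βl βu k0 * k0) hρ0 hA hB hT
    (by rw [Real.tanh_eq_sinh_div_cosh]; field_simp) (by positivity)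
    (by field_simp; linarith) (Real.sqrt_pos.mpr hD)
    (by
      rw [Real.sq_sqrt hD.le, ← hsech]
      unfold Dfun
      rw [abs_of_pos hk0]
      ring)
    (by
      have hQ : 1 + ρ * Real.tanh k0 ≠ 0 := by positivity
      unfold lamM
      rw [abs_of_pos hk0]
      field_simp)
  have hG : gmat ρ βl βu k0 k0 =
      !![1 - ρ + βl * k0 ^ 2 - lamM ρ βl βu k0 * k0 * (1 + ρ * (Real.cosh k0 / Real.sinh k0)),
          ρ * (lamM ρ βl βu k0 * k0 * (1 / Real.sinh k0));
        ρ * (lamM ρ βl βu k0 * k0 * (1 / Real.sinh k0)),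
          ρ * (1 + βu * k0 ^ 2 - lamM ρ βl βu k0 * k0 * (Real.cosh k0 / Real.sinh k0))] := by
    ext i j
    fin_cases i <;> fin_cases j <;> simp [gmat, Pmat, Fmat, abs_of_pos hk0] <;> ring
  rw [hG]
  set x := 1 - ρ + βl * k0 ^ 2 - lamM ρ βl βu k0 * k0 * (1 + ρ * (Real.cosh k0 / Real.sinh k0))
  set y := 1 + βu * k0 ^ 2 - lamM ρ βl βu k0 * k0 * (Real.cosh k0 / Real.sinh k0)
  have hz : 0 < lamM ρ βl βu k0 * k0 * (1 / Real.sinh k0) := by positivity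
  set z := lamM ρ βl βu k0 * k0 * (1 / Real.sinh k0)
  refine ⟨?_, x / (ρ * z), by positivity, ?_⟩
  · rw [det_fin_two_of]
    linear_combination ρ * hdet
  · have h₁ : x * 1 + ρ * z * -(x / (ρ * z)) = 0 := by
      field_simp
      ring
    have h₂ : ρ * z * 1 + ρ * y * -(x / (ρ * z)) = 0 := by
      field_simp
      linear_combination -hdet
    ext i
    fin_cases i
    · simpa [mulVec, dotProduct, Fin.sum_univ_two] using h₁
    · simpa [mulVec, dotProduct, Fin.sum_univ_two] using h₂
end

section
/- Fix any k0 > 0. For every k ≠ 0 and every w ∈ ℝ² one has g(k)w·w ≥ (λ_−(k) − λ_−(k0)) F(k)w·w. In particular, if λ_−(k0) ≤ λ_−(k) for all k ≠ 0, then g(k) is positive semidefinite for every k ≠ 0. -/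
open Matrix

/-- A binary quadratic form with positive last coefficient and zero determinant is nonnegative. -/
theorem quadForm_nonneg_of_det_eq_zero {p q r : ℝ} (hr : 0 < r) (hdet : p * r - q ^ 2 = 0)
    (x y : ℝ) : 0 ≤ p * x ^ 2 + 2 * q * x * y + r * y ^ 2 := by
  have h : r * (p * x ^ 2 + 2 * q * x * y + r * y ^ 2) = (q * x + r * y) ^ 2 := by
    linear_combination x ^ 2 * hdet
  exact nonneg_of_mul_nonneg_right (h ▸ sq_nonneg _) hr

/-- The smaller root `x` of `(1 + ρ T) x ^ 2 - (a + b (T + ρ)) x + a b T` satisfies `x < b T`. -/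
theorem smaller_root_spec {ρ a b T d x : ℝ} (hρ : 0 < ρ) (ha : 0 < a) (hb : 0 < b) (hT : 0 < T)
    (hT1 : T < 1) (hd : d = (a - (T + ρ) * b) ^ 2 + 4 * ρ * (1 - T ^ 2) * a * b)
    (hx : 2 * (1 + ρ * T) * x = a + b * (T + ρ) - √d) :
    (1 + ρ * T) * x ^ 2 - (a + b * (T + ρ)) * x + a * b * T = 0 ∧ x < b * T := by
  have hpos : 0 < 1 + ρ * T := by positivity
  have hT2 : 0 < 1 - T ^ 2 := by nlinarith
  have hd0 : 0 ≤ d := by rw [hd]; positivity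
  have hsq : √d ^ 2 = d := Real.sq_sqrt hd0
  refine ⟨?_, ?_⟩
  · have hroot : √d = a + b * (T + ρ) - 2 * (1 + ρ * T) * x := by linarith
    rw [hroot, hd] at hsq
    refine (mul_eq_zero.mp (?_ : 4 * (1 + ρ * T) * _ = 0)).resolve_left (by positivity)
    linear_combination hsq
  · have hlt : a + b * (T + ρ) - 2 * (1 + ρ * T) * (b * T) < √d := by
      refine Real.lt_sqrt_of_sq_lt ?_
      have : 0 < 4 * (1 + ρ * T) * (b ^ 2 * T * ρ * (1 - T ^ 2)) := by positivity
      rw [hd]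
      nlinarith
    have : 2 * (1 + ρ * T) * x < 2 * (1 + ρ * T) * (b * T) := by linarith
    exact lt_of_mul_lt_mul_left this (by positivity)

theorem fmat_dotProduct (ρ k : ℝ) (w : Fin 2 → ℝ) :
    (Fmat ρ k *ᵥ w) ⬝ᵥ w =
      (|k| + ρ * |k| * (Real.cosh |k| / Real.sinh |k|)) * w 0 ^ 2
        + 2 * -(ρ * |k| / Real.sinh |k|) * w 0 * w 1
        + ρ * |k| * (Real.cosh |k| / Real.sinh |k|) * w 1 ^ 2 := by
  simp only [Fmat, dotProduct, mulVec, Fin.sum_univ_two, of_apply, cons_val_zero, cons_val_one,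
    cons_val', cons_val_fin_one]
  ring

theorem fmat_dotProduct_nonneg {ρ : ℝ} (hρ : 0 < ρ) (k : ℝ) (w : Fin 2 → ℝ) :
    0 ≤ (Fmat ρ k *ᵥ w) ⬝ᵥ w := by
  rcases eq_or_ne k 0 with rfl | hk
  · rw [fmat_dotProduct]; simp
  have hK : 0 < |k| := abs_pos.mpr hk
  have hs : 0 < Real.sinh |k| := Real.sinh_pos_iff.mpr hK
  have hc : 1 ≤ Real.cosh |k| := Real.one_le_cosh _
  have h : (Fmat ρ k *ᵥ w) ⬝ᵥ w = |k| * w 0 ^ 2 + ρ * |k| / Real.sinh |k| *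
      ((Real.cosh |k| - 1) * (w 0 ^ 2 + w 1 ^ 2) + (w 0 - w 1) ^ 2) := by
    rw [fmat_dotProduct]; ring
  have := sub_nonneg.mpr hc
  rw [h]
  positivity

theorem pmat_dotProduct (ρ βl βu k : ℝ) (w : Fin 2 → ℝ) :
    (Pmat ρ βl βu k *ᵥ w) ⬝ᵥ w =
      (1 - ρ + βl * k ^ 2) * w 0 ^ 2 + ρ * (1 + βu * k ^ 2) * w 1 ^ 2 := by
  simp only [Pmat, dotProduct, mulVec, Fin.sum_univ_two, of_apply, cons_val_zero, cons_val_one,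
    cons_val', cons_val_fin_one]
  ring

theorem gmat_dotProduct (ρ βl βu k0 k : ℝ) (w : Fin 2 → ℝ) :
    (gmat ρ βl βu k0 k *ᵥ w) ⬝ᵥ w =
      (Pmat ρ βl βu k *ᵥ w) ⬝ᵥ w - lamM ρ βl βu k0 * ((Fmat ρ k *ᵥ w) ⬝ᵥ w) := by
  simp only [gmat, sub_mulVec, smul_mulVec, sub_dotProduct, smul_dotProduct, smul_eq_mul]

theorem lamM_mul_fmat_le_pmat {ρ βl βu k : ℝ} (hρ : ρ ∈ Set.Ioo (0 : ℝ) 1) (hβl : 0 < βl)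
    (hβu : 0 < βu) (hk : k ≠ 0) (w : Fin 2 → ℝ) :
    lamM ρ βl βu k * ((Fmat ρ k *ᵥ w) ⬝ᵥ w) ≤ (Pmat ρ βl βu k *ᵥ w) ⬝ᵥ w := by
  obtain ⟨hρ0, hρ1⟩ := hρ
  have hK : 0 < |k| := abs_pos.mpr hk
  have hs : 0 < Real.sinh |k| := Real.sinh_pos_iff.mpr hK
  have hc : 0 < Real.cosh |k| := Real.cosh_pos _
  have hcs : Real.cosh |k| ^ 2 = Real.sinh |k| ^ 2 + 1 := Real.cosh_sq _
  have ha : 0 < 1 - ρ + βl * k ^ 2 := by have := sub_pos.mpr hρ1; positivity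
  have hb : 0 < 1 + βu * k ^ 2 := by positivity
  have hTdef : Real.tanh |k| = Real.sinh |k| / Real.cosh |k| := Real.tanh_eq_sinh_div_cosh _
  have hT : 0 < Real.tanh |k| := by rw [hTdef]; positivity
  have hd : Dfun ρ βl βu k = ((1 - ρ + βl * k ^ 2)
      - (Real.tanh |k| + ρ) * (1 + βu * k ^ 2)) ^ 2
      + 4 * ρ * (1 - Real.tanh |k| ^ 2) * (1 - ρ + βl * k ^ 2) * (1 + βu * k ^ 2) := by
    have : 1 - Real.tanh |k| ^ 2 = 1 / Real.cosh |k| ^ 2 := by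
      rw [hTdef]; field_simp; linarith
    rw [Dfun, this]; ring
  have hx : 2 * (1 + ρ * Real.tanh |k|) * (lamM ρ βl βu k * |k|) =
      (1 - ρ + βl * k ^ 2) + (1 + βu * k ^ 2) * (Real.tanh |k| + ρ) - √(Dfun ρ βl βu k) := by
    have : 0 < 1 + ρ * Real.tanh |k| := by positivity
    rw [lamM]; field_simp
  obtain ⟨hroot, hlt⟩ := smaller_root_spec hρ0 ha hb hT (Real.tanh_lt_one _) hd hx
  rw [fmat_dotProduct, pmat_dotProduct]
  generalize 1 - ρ + βl * k ^ 2 = a at *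
  generalize 1 + βu * k ^ 2 = b at *
  generalize lamM ρ βl βu k = l at *
  rw [hTdef] at hroot hlt
  generalize Real.sinh |k| = s at *
  generalize Real.cosh |k| = c at *
  generalize |k| = K at *
  have hr : 0 < ρ * b - l * (ρ * K * (c / s)) := by
    have : ρ * b - l * (ρ * K * (c / s)) = ρ * (c / s) * (b * (s / c) - l * K) := by field_simp
    rw [this]
    have := sub_pos.mpr hlt
    positivity
  have hdet : (a - l * (K + ρ * K * (c / s))) * (ρ * b - l * (ρ * K * (c / s)))
      - (l * (ρ * K / s)) ^ 2 = 0 := by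
    linear_combination (norm := (field_simp; ring))
      ρ * (c / s) * hroot + l ^ 2 * ρ ^ 2 * K ^ 2 / s ^ 2 * hcs
  linarith [quadForm_nonneg_of_det_eq_zero hr hdet (w 0) (w 1)]

/-- For a fixed `k₀ > 0`: for every `k ≠ 0` and `w ∈ ℝ²`,
`g(k)w·w ≥ (λ₋(k) − λ₋(k₀)) F(k)w·w`; in particular, if `λ₋(k₀) ≤ λ₋(k)` for all
`k ≠ 0` then `g(k)` is positive semidefinite for every `k ≠ 0`. -/
theorem gmat_lower_bound (ρ βl βu : ℝ) (hρ : ρ ∈ Set.Ioo (0:ℝ) 1) (hβl : 0 < βl)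
    (hβu : 0 < βu) (k0 : ℝ) (hk0 : 0 < k0) :
    (∀ k : ℝ, k ≠ 0 → ∀ w : Fin 2 → ℝ,
        (lamM ρ βl βu k - lamM ρ βl βu k0) * ((Fmat ρ k *ᵥ w) ⬝ᵥ w)
          ≤ (gmat ρ βl βu k0 k *ᵥ w) ⬝ᵥ w) ∧
      ((∀ k : ℝ, k ≠ 0 → lamM ρ βl βu k0 ≤ lamM ρ βl βu k) →
        ∀ k : ℝ, k ≠ 0 → ∀ w : Fin 2 → ℝ, 0 ≤ (gmat ρ βl βu k0 k *ᵥ w) ⬝ᵥ w) := by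
  have key : ∀ k : ℝ, k ≠ 0 → ∀ w : Fin 2 → ℝ,
      (lamM ρ βl βu k - lamM ρ βl βu k0) * ((Fmat ρ k *ᵥ w) ⬝ᵥ w)
        ≤ (gmat ρ βl βu k0 k *ᵥ w) ⬝ᵥ w := by
    intro k hk w
    rw [gmat_dotProduct, sub_mul]
    exact sub_le_sub_right (lamM_mul_fmat_le_pmat hρ hβl hβu hk w) _
  refine ⟨key, fun hmin k hk w => le_trans ?_ (key k hk w)⟩
  exact mul_nonneg (sub_nonneg.mpr (hmin k hk)) (fmat_dotProduct_nonneg hρ.1 k w)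
end

section
/- Suppose k0 > 0 satisfies Assumption 1, i.e. λ_−(k) > λ_−(k0) for all k ≠ ±k0 and λ_−''(k0) > 0. Then there exist constants c > 0 and δ > 0 such that g(k)w·w ≥ c (|k| − k0)² |w|² for every w ∈ ℝ² and every k ≠ 0 with ||k| − k0| ≤ δ. -/
open Matrix

/-- Second derivative test, quantitatively. -/
lemma eventually_quadratic_growth_of_deriv_deriv_pos {f : ℝ → ℝ} {a : ℝ}
    (hf : ∀ᶠ x in nhds a, DifferentiableAt ℝ f x) (h1 : deriv f a = 0)
    (h2 : 0 < deriv (deriv f) a) :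
    ∀ᶠ x in nhds a, deriv (deriv f) a / 4 * (x - a) ^ 2 ≤ f x - f a := by
  set μ := deriv (deriv f) a with hμ
  have hq (x : ℝ) : HasDerivAt (fun y => μ / 4 * (y - a) ^ 2) (μ / 2 * (x - a)) x := by
    refine ((((hasDerivAt_id' x).sub_const a).pow 2).const_mul (μ / 4)).congr_deriv ?_
    norm_num
    ring
  have hd : deriv (fun x => f x - μ / 4 * (x - a) ^ 2) =ᶠ[nhds a]
      fun x => deriv f x - μ / 2 * (x - a) := by
    filter_upwards [hf] with x hx
    exact (hx.hasDerivAt.sub (hq x)).deriv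
  have hdd : DifferentiableAt ℝ (deriv f) a := differentiableAt_of_deriv_ne_zero h2.ne'
  have h2' : deriv (deriv (fun x => f x - μ / 4 * (x - a) ^ 2)) a = μ / 2 := by
    rw [hd.deriv_eq]
    refine (hdd.hasDerivAt.sub (((hasDerivAt_id' a).sub_const a).const_mul (μ / 2))).deriv.trans ?_
    rw [← hμ]
    ring
  have hmin : IsLocalMin (fun x => f x - μ / 4 * (x - a) ^ 2) a := by
    refine isLocalMin_of_deriv_deriv_pos ?_ ?_ ?_
    · rw [h2']
      linarith
    · rw [hd.eq_of_nhds, h1]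
      ring
    · exact (hf.self_of_nhds.sub (hq a).differentiableAt).continuousAt
  filter_upwards [hmin] with x hx
  simp only [sub_self] at hx
  linarith

lemma lamM_abs (ρ βl βu k : ℝ) : lamM ρ βl βu |k| = lamM ρ βl βu k := by
  simp only [lamM, Dfun, abs_abs, sq_abs]

lemma Real.tanh_pos_of_pos {t : ℝ} (ht : 0 < t) : 0 < Real.tanh t := by
  rw [Real.tanh_eq_sinh_div_cosh]
  exact div_pos (Real.sinh_pos_iff.2 ht) (Real.cosh_pos t)

lemma nonneg_of_smaller_root {p q a b d B lam : ℝ} (ha : 0 < a)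
    (hA : 0 < a * d - b ^ 2) (hB : 2 * (a * d - b ^ 2) * lam ≤ B) (htr : B = p * d + q * a)
    (hroot : (p - lam * a) * (q - lam * d) = (lam * b) ^ 2) : 0 ≤ p - lam * a := by
  by_contra! hu
  have h1 : (a * d - b ^ 2) * (p + lam * a) - a * B < 0 := by
    nlinarith [mul_pos hA (neg_pos.2 hu), mul_le_mul_of_nonneg_left hB ha.le]
  have h2 : (p - lam * a) * ((a * d - b ^ 2) * (p + lam * a) - a * B) = -(p * b) ^ 2 := by
    rw [htr]
    linear_combination -a ^ 2 * hroot
  nlinarith [mul_pos_of_neg_of_neg hu h1, sq_nonneg (p * b)]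

lemma quadratic_form_nonneg_of_mul_eq_sq {u v m : ℝ} (hu : 0 ≤ u) (hv : 0 ≤ v)
    (h : u * v = m ^ 2) (x y : ℝ) : 0 ≤ u * x ^ 2 - 2 * m * x * y + v * y ^ 2 := by
  rcases hu.eq_or_lt with rfl | hu
  · have hm : m = 0 := by simpa using h.symm
    rw [hm]
    nlinarith [mul_nonneg hv (sq_nonneg y)]
  · refine nonneg_of_mul_nonneg_right ?_ hu
    have : u * (u * x ^ 2 - 2 * m * x * y + v * y ^ 2) = (u * x - m * y) ^ 2 := by
      linear_combination y ^ 2 * h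
    rw [this]
    positivity

section

variable {ρ βl βu : ℝ}

lemma Dfun_pos (hρ : ρ ∈ Set.Ioo (0 : ℝ) 1) (hβl : 0 < βl) (hβu : 0 < βu) (k : ℝ) :
    0 < Dfun ρ βl βu k := by
  obtain ⟨h0, h1⟩ := hρ
  have hp : 0 < 1 - ρ + βl * k ^ 2 := by
    have := mul_nonneg hβl.le (sq_nonneg k)
    linarith
  have hc := Real.cosh_pos |k|
  unfold Dfun
  positivity

lemma differentiableAt_lamM (hρ : ρ ∈ Set.Ioo (0 : ℝ) 1) (hβl : 0 < βl) (hβu : 0 < βu) {k : ℝ}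
    (hk : 0 < k) : DifferentiableAt ℝ (lamM ρ βl βu) k := by
  have habs : DifferentiableAt ℝ (fun x : ℝ => |x|) k := differentiableAt_abs hk.ne'
  have htanh : DifferentiableAt ℝ (fun x : ℝ => Real.tanh |x|) k := by
    simp only [Real.tanh_eq_sinh_div_cosh]
    exact habs.sinh.div habs.cosh (Real.cosh_pos _).ne'
  have hD : DifferentiableAt ℝ (Dfun ρ βl βu) k := by
    unfold Dfun
    have : DifferentiableAt ℝ (fun x : ℝ => 4 * ρ / Real.cosh |x| ^ 2) k :=
      (differentiableAt_const _).div (habs.cosh.pow 2) (pow_pos (Real.cosh_pos _) 2).ne'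
    fun_prop
  have hsqrt : DifferentiableAt ℝ (fun x => √(Dfun ρ βl βu x)) k :=
    hD.sqrt (Dfun_pos hρ hβl hβu k).ne'
  have ht := Real.tanh_pos_of_pos (abs_pos.2 hk.ne')
  have hne : 2 * |k| * (1 + ρ * Real.tanh |k|) ≠ 0 := by
    have := hρ.1
    positivity
  unfold lamM
  exact DifferentiableAt.div (by fun_prop) (by fun_prop) hne

lemma Fmat_form_lower_bound (h0 : 0 < ρ) {k : ℝ} (hk : k ≠ 0) (w : Fin 2 → ℝ) :
    ρ * |k| * ((Real.cosh |k| - 1) / Real.sinh |k|) * (w ⬝ᵥ w) ≤ (Fmat ρ k *ᵥ w) ⬝ᵥ w := by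
  have ha := abs_pos.2 hk
  have hs := Real.sinh_pos_iff.2 ha
  have key : (Fmat ρ k *ᵥ w) ⬝ᵥ w - ρ * |k| * ((Real.cosh |k| - 1) / Real.sinh |k|) * (w ⬝ᵥ w)
      = |k| * w 0 ^ 2 + ρ * |k| / Real.sinh |k| * (w 0 - w 1) ^ 2 := by
    simp [Fmat, mulVec, dotProduct, Fin.sum_univ_two]
    field_simp
    ring
  have : 0 ≤ |k| * w 0 ^ 2 + ρ * |k| / Real.sinh |k| * (w 0 - w 1) ^ 2 := by positivity
  linarith

lemma Pmat_sub_lamM_smul_Fmat_form_nonneg (hρ : ρ ∈ Set.Ioo (0 : ℝ) 1) (hβl : 0 < βl)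
    (hβu : 0 < βu) {k : ℝ} (hk : k ≠ 0) (w : Fin 2 → ℝ) :
    0 ≤ ((Pmat ρ βl βu k - lamM ρ βl βu k • Fmat ρ k) *ᵥ w) ⬝ᵥ w := by
  have hρ0 := hρ.1
  have hK := abs_pos.2 hk
  have hr := Real.sq_sqrt (Dfun_pos hρ hβl hβu k).le
  have hr0 := Real.sqrt_nonneg (Dfun ρ βl βu k)
  have hlam : lamM ρ βl βu k = ((1 - ρ + βl * k ^ 2) +
    (1 + βu * k ^ 2) * (Real.tanh |k| + ρ) - √(Dfun ρ βl βu k)) /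
      (2 * |k| * (1 + ρ * Real.tanh |k|)) := rfl
  set r := √(Dfun ρ βl βu k)
  rw [Dfun] at hr
  simp only [Pmat, Fmat]
  set lam := lamM ρ βl βu k
  set p := 1 - ρ + βl * k ^ 2
  set q := 1 + βu * k ^ 2
  set K := |k|
  have hs := Real.sinh_pos_iff.2 hK
  have hc := Real.cosh_pos K
  have hcs := Real.cosh_sq K
  rw [Real.tanh_eq_sinh_div_cosh] at hlam hr
  set s := Real.sinh K
  set c := Real.cosh K
  have hE : 0 < K * (1 + ρ * (s / c)) := by positivity
  have hlam' : 2 * (K * (1 + ρ * (s / c))) * lam = p + q * (s / c + ρ) - r := by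
    rw [hlam]
    field_simp
  have hdet : (K + ρ * K * (c / s)) * (ρ * K * (c / s)) - (ρ * K / s) ^ 2 =
      ρ * K * (c / s) * (K * (1 + ρ * (s / c))) := by
    field_simp
    linear_combination ρ * hcs
  have htr : ρ * K * (c / s) * (p + q * (s / c + ρ)) =
      p * (ρ * K * (c / s)) + (ρ * q) * (K + ρ * K * (c / s)) := by
    field_simp
  have hquad : (K * (1 + ρ * (s / c))) * ((K * (1 + ρ * (s / c))) * lam ^ 2
      - (p + q * (s / c + ρ)) * lam + p * q * (s / c) / K) = 0 := by
    have hD : r ^ 2 = (p + q * (s / c + ρ)) ^ 2 - 4 * (1 + ρ * (s / c)) * (s / c) * p * q := by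
      rw [hr]
      field_simp
      linear_combination -4 * p * q * ρ * hcs
    have hcancel : K * (1 + ρ * (s / c)) * (p * q * (s / c) / K) =
        (1 + ρ * (s / c)) * (s / c) * p * q := by
      field_simp
    have hr' : r = p + q * (s / c + ρ) - 2 * (K * (1 + ρ * (s / c))) * lam := by linarith
    rw [hr'] at hD
    linear_combination hD / 4 + hcancel
  have hroot : (p - lam * (K + ρ * K * (c / s))) * (ρ * q - lam * (ρ * K * (c / s))) =
      (lam * (ρ * K / s)) ^ 2 := by
    have h0 := (mul_eq_zero.1 hquad).resolve_left hE.ne'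
    have hC : ρ * K * (c / s) * (p * q * (s / c) / K) = p * (ρ * q) := by
      field_simp
    linear_combination ρ * K * (c / s) * h0 + lam ^ 2 * hdet + lam * htr - hC
  have hA : 0 < (K + ρ * K * (c / s)) * (ρ * K * (c / s)) - (ρ * K / s) ^ 2 := by
    rw [hdet]
    positivity
  have hB : 2 * ((K + ρ * K * (c / s)) * (ρ * K * (c / s)) - (ρ * K / s) ^ 2) * lam ≤
      ρ * K * (c / s) * (p + q * (s / c + ρ)) := by
    rw [hdet]
    have hm : 0 ≤ ρ * K * (c / s) := by positivity
    nlinarith [mul_nonneg hm hr0]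
  have hu := nonneg_of_smaller_root (by positivity) hA hB htr hroot
  have hv := nonneg_of_smaller_root (a := ρ * K * (c / s)) (d := K + ρ * K * (c / s))
    (b := ρ * K / s) (p := ρ * q) (q := p) (lam := lam) (by positivity)
    (by linarith) (by linarith) (htr.trans (add_comm _ _)) ((mul_comm _ _).trans hroot)
  convert quadratic_form_nonneg_of_mul_eq_sq hu hv hroot (w 0) (-w 1) using 1
  simp [mulVec, dotProduct, Fin.sum_univ_two]
  ring

end

/-- Under Assumption 1 (`λ₋(k) > λ₋(k₀)` for all `k ≠ ±k₀` and
`λ₋''(k₀) > 0`) there are `c > 0`, `δ > 0` such that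
`g(k)w·w ≥ c (|k| − k₀)² |w|²` for all `w ∈ ℝ²` and all `k ≠ 0` with `||k| − k₀| ≤ δ`. -/
theorem gmat_coercive_near_k0 (ρ βl βu : ℝ) (hρ : ρ ∈ Set.Ioo (0:ℝ) 1) (hβl : 0 < βl)
    (hβu : 0 < βu) (k0 : ℝ) (hk0 : 0 < k0)
    (hmin : ∀ k : ℝ, k ≠ 0 → k ≠ k0 → k ≠ -k0 → lamM ρ βl βu k0 < lamM ρ βl βu k)
    (hnondeg : 0 < deriv (deriv (lamM ρ βl βu)) k0) :
    ∃ c > (0:ℝ), ∃ δ > (0:ℝ), ∀ k : ℝ, k ≠ 0 → |(|k| - k0)| ≤ δ →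
      ∀ w : Fin 2 → ℝ,
        c * (|k| - k0) ^ 2 * (w ⬝ᵥ w) ≤ (gmat ρ βl βu k0 k *ᵥ w) ⬝ᵥ w := by
  have hdiff : ∀ᶠ x in nhds k0, DifferentiableAt ℝ (lamM ρ βl βu) x := by
    filter_upwards [lt_mem_nhds hk0] with x hx
    exact differentiableAt_lamM hρ hβl hβu hx
  have hderiv : deriv (lamM ρ βl βu) k0 = 0 := by
    refine IsLocalMin.deriv_eq_zero ?_
    filter_upwards [lt_mem_nhds hk0] with x hx
    rcases eq_or_ne x k0 with rfl | hne
    · exact le_rfl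
    · exact (hmin x hx.ne' hne (by linarith)).le
  have hgrowth := eventually_quadratic_growth_of_deriv_deriv_pos hdiff hderiv hnondeg
  set μ := deriv (deriv (lamM ρ βl βu)) k0
  have hs := Real.sinh_pos_iff.2 hk0
  have hm : 0 < ρ * k0 * ((Real.cosh k0 - 1) / Real.sinh k0) := by
    have := Real.one_lt_cosh.2 hk0.ne'
    have := hρ.1
    have : 0 < Real.cosh k0 - 1 := by linarith
    positivity
  have hcont : ContinuousAt (fun x => ρ * x * ((Real.cosh x - 1) / Real.sinh x)) k0 := by
    have : ContinuousAt (fun x => (Real.cosh x - 1) / Real.sinh x) k0 :=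
      (Real.continuous_cosh.continuousAt.sub continuousAt_const).div
        Real.continuous_sinh.continuousAt hs.ne'
    fun_prop
  set m := ρ * k0 * ((Real.cosh k0 - 1) / Real.sinh k0)
  have hlower := hcont.eventually (lt_mem_nhds (half_lt_self hm))
  obtain ⟨δ, hδ, hball⟩ := Metric.nhds_basis_closedBall.eventually_iff.1 (hgrowth.and hlower)
  refine ⟨μ / 4 * (m / 2), by positivity, δ, hδ, fun k hk hkδ w => ?_⟩
  obtain ⟨h1, h2⟩ := hball (x := |k|) (by rwa [Metric.mem_closedBall, Real.dist_eq])
  rw [lamM_abs] at h1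
  have hw : 0 ≤ w ⬝ᵥ w := by
    simp only [dotProduct, Fin.sum_univ_two]
    nlinarith [sq_nonneg (w 0), sq_nonneg (w 1)]
  have hF : m / 2 * (w ⬝ᵥ w) ≤ (Fmat ρ k *ᵥ w) ⬝ᵥ w :=
    (mul_le_mul_of_nonneg_right h2.le hw).trans (Fmat_form_lower_bound hρ.1 hk w)
  have hP := Pmat_sub_lamM_smul_Fmat_form_nonneg hρ hβl hβu hk w
  have hsplit : (gmat ρ βl βu k0 k *ᵥ w) ⬝ᵥ w =
      ((Pmat ρ βl βu k - lamM ρ βl βu k • Fmat ρ k) *ᵥ w) ⬝ᵥ w +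
        (lamM ρ βl βu k - lamM ρ βl βu k0) * ((Fmat ρ k *ᵥ w) ⬝ᵥ w) := by
    simp only [gmat, sub_mulVec, sub_dotProduct, smul_mulVec, smul_dotProduct, smul_eq_mul]
    ring
  have hsq : 0 ≤ μ / 4 * (|k| - k0) ^ 2 := by positivity
  have hprod := mul_le_mul h1 hF (by positivity) (hsq.trans h1)
  rw [hsplit]
  linarith
end

section
/- Let φ : ℝ → ℂ be a twice continuously differentiable solution of −(A2/4)φ'' − 2ν_NLS φ + (3/2)B |φ|²φ = 0 with φ(x) → 0 as x → ±∞. If φ is not identically zero, then there exist ω ∈ [0, 2π) and y ∈ ℝ such that φ(x) = e^{iω} φ_NLS(x + y) for all x ∈ ℝ. -/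
open Real

/-- The NLS soliton profile `φ_NLS(x) = α(−3B/A₂)^{1/2} sech(−(3αB/A₂)x)`,
where `sech t = 1/cosh t`. -/
noncomputable def phiNLS (A2 B α : ℝ) (x : ℝ) : ℝ :=
  α * Real.sqrt (-3 * B / A2) * (1 / Real.cosh (-(3 * α * B / A2) * x))

open Filter Topology in
/-- If a function and its second derivative tend to zero at infinity, so does its derivative. -/
theorem tendsto_deriv_zero_of_tendsto_zero {f f₁ f₂ : ℝ → ℝ}
    (hf : ∀ x, HasDerivAt f (f₁ x) x) (hf₁ : ∀ x, HasDerivAt f₁ (f₂ x) x)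
    (h0 : Tendsto f atTop (𝓝 0)) (h2 : Tendsto f₂ atTop (𝓝 0)) :
    Tendsto f₁ atTop (𝓝 0) := by
  rw [Metric.tendsto_atTop] at h0 h2 ⊢
  intro ε hε
  obtain ⟨N₀, hN₀⟩ := h0 (ε / 4) (by positivity)
  obtain ⟨N₂, hN₂⟩ := h2 (ε / 4) (by positivity)
  refine ⟨max N₀ N₂, fun x hx => ?_⟩
  have hx₀ : N₀ ≤ x := (le_max_left _ _).trans hx
  have hx₂ : N₂ ≤ x := (le_max_right _ _).trans hx
  obtain ⟨ξ, hξ, hξe⟩ := exists_hasDerivAt_eq_slope f f₁ (lt_add_one x)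
    (fun y _ => (hf y).continuousAt.continuousWithinAt) (fun y _ => hf y)
  obtain ⟨η, hη, hηe⟩ := exists_hasDerivAt_eq_slope f₁ f₂ hξ.1
    (fun y _ => (hf₁ y).continuousAt.continuousWithinAt) (fun y _ => hf₁ y)
  have a1 := hN₀ x hx₀
  have a2 := hN₀ (x + 1) (by linarith)
  have a3 := hN₂ η (hx₂.trans hη.1.le)
  rw [Real.dist_eq, sub_zero] at a1 a2 a3 ⊢
  rw [add_sub_cancel_left, div_one] at hξe
  rw [eq_div_iff (by linarith [hξ.1])] at hηe
  have a4 : |f₁ ξ - f₁ x| ≤ ε / 4 := by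
    rw [← hηe, abs_mul, abs_of_pos (sub_pos.2 hξ.1)]
    nlinarith [hξ.1, hξ.2, abs_nonneg (f₂ η)]
  rw [abs_lt] at a1 a2 ⊢
  rw [abs_le] at a4
  constructor <;> linarith

/-- A function with zero derivative tending to zero at infinity vanishes. -/
theorem eq_zero_of_hasDerivAt_zero_of_tendsto {f : ℝ → ℝ} (hf : ∀ x, HasDerivAt f 0 x)
    (h0 : Filter.Tendsto f Filter.atTop (nhds 0)) (x : ℝ) : f x = 0 := by
  have hc : ∀ y, f y = f x := fun y =>
    is_const_of_deriv_eq_zero (fun z => (hf z).differentiableAt) (fun z => (hf z).deriv) y x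
  rw [funext hc] at h0
  exact tendsto_nhds_unique tendsto_const_nhds h0

/-- A nonnegative function with `|r₁| ≤ k r` that vanishes somewhere vanishes identically. -/
theorem eq_zero_of_abs_deriv_le {r r₁ : ℝ → ℝ} {k : ℝ} (hr : ∀ x, HasDerivAt r (r₁ x) x)
    (hnn : ∀ x, 0 ≤ r x) (hle : ∀ x, |r₁ x| ≤ k * r x) {x₀ : ℝ} (h0 : r x₀ = 0) (x : ℝ) :
    r x = 0 := by
  have hd : ∀ s y, HasDerivAt (fun z => r z * exp (s * z)) ((r₁ y + s * r y) * exp (s * y)) y := by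
    intro s y
    have h := (hr y).mul (((hasDerivAt_id y).const_mul s).exp)
    refine h.congr_deriv ?_
    simp; ring
  have hmono : Monotone (fun z => r z * exp (k * z)) :=
    monotone_of_hasDerivAt_nonneg (hd k) fun y =>
      mul_nonneg (by linarith [(abs_le.1 (hle y)).1]) (exp_pos _).le
  have hanti : Antitone (fun z => r z * exp (-k * z)) :=
    antitone_of_hasDerivAt_nonpos (hd (-k)) fun y =>
      mul_nonpos_of_nonpos_of_nonneg (by linarith [(abs_le.1 (hle y)).2]) (exp_pos _).le
  refine le_antisymm ?_ (hnn x)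
  rcases le_total x x₀ with h | h
  · have := hmono h
    simp only [h0, zero_mul] at this
    exact nonpos_of_mul_nonpos_left this (exp_pos _)
  · have := hanti h
    simp only [h0, zero_mul] at this
    exact nonpos_of_mul_nonpos_left this (exp_pos _)

/-- Solutions of the Riccati equation `w' = w² - k²` with values in `(-k, k)`. -/
theorem exists_shift_of_riccati {w : ℝ → ℝ} {k : ℝ} (hk : 0 < k)
    (hw : ∀ x, HasDerivAt w (w x ^ 2 - k ^ 2) x) (hlt : ∀ x, |w x| < k) :
    ∃ y, ∀ x, w x * cosh (k * (x + y)) = -k * sinh (k * (x + y)) := by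
  have h1 : ∀ x, 0 < k - w x := fun x => sub_pos.2 (abs_lt.1 (hlt x)).2
  have h2 : ∀ x, 0 < k + w x := fun x => by linarith [(abs_lt.1 (hlt x)).1]
  have hd : ∀ x, HasDerivAt (fun z => (log (k - w z) - log (k + w z)) - 2 * k * z) 0 x := by
    intro x
    have ha := ((hw x).const_sub k).log (h1 x).ne'
    have hb := ((hw x).const_add k).log (h2 x).ne'
    have h := (ha.sub hb).sub ((hasDerivAt_id x).const_mul (2 * k))
    refine h.congr_deriv ?_
    have := (h1 x).ne'
    have := (h2 x).ne'
    field_simp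
    ring
  have hc := fun x => is_const_of_deriv_eq_zero (fun z => (hd z).differentiableAt)
    (fun z => (hd z).deriv) x 0
  set K := (log (k - w 0) - log (k + w 0)) - 2 * k * 0
  refine ⟨K / (2 * k), fun x => ?_⟩
  set t := k * (x + K / (2 * k)) with ht
  have hlog : log (k - w x) = log (k + w x) + (t + t) := by
    have hx := hc x
    have : t + t = 2 * k * x + K := by rw [ht]; field_simp; ring
    linarith
  have he : k - w x = (k + w x) * (exp t * exp t) := by
    rw [← exp_log (h1 x), hlog, exp_add, exp_log (h2 x), exp_add]
  have hi : exp t * exp (-t) = 1 := by rw [← exp_add]; simp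
  rw [cosh_eq, sinh_eq]
  linear_combination (-exp (-t) / 2) * he - (exp t * (k + w x) / 2) * hi

/-- If `u' = w u` with `w = -k tanh (k (x + y))` then `u` is a multiple of
`sech (k (x + y))`. -/
theorem mul_cosh_eq_of_hasDerivAt {u w : ℝ → ℝ} {k y : ℝ}
    (hu : ∀ x, HasDerivAt u (w x * u x) x)
    (hw : ∀ x, w x * cosh (k * (x + y)) = -k * sinh (k * (x + y))) (x : ℝ) :
    u x * cosh (k * (x + y)) = u (-y) := by
  have hd : ∀ x, HasDerivAt (fun z => u z * cosh (k * (z + y))) 0 x := by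
    intro x
    have h := (hu x).mul ((((hasDerivAt_id x).add_const y).const_mul k).cosh)
    refine h.congr_deriv ?_
    simp only [id]
    linear_combination u x * hw x
  have := is_const_of_deriv_eq_zero (fun z => (hd z).differentiableAt)
    (fun z => (hd z).deriv) x (-y)
  simpa using this

open Filter Topology in
/-- Nonzero solutions of the planar system `φ'' = k² φ - c |φ|² φ` that decay at `+∞`, in real
coordinates `φ = (u, v)`. -/
theorem exists_sech_of_planar_ode {u v p q : ℝ → ℝ} {k c : ℝ} (hk : 0 < k) (hc : 0 < c)
    (hu : ∀ x, HasDerivAt u (p x) x) (hv : ∀ x, HasDerivAt v (q x) x)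
    (hp : ∀ x, HasDerivAt p ((k ^ 2 - c * (u x ^ 2 + v x ^ 2)) * u x) x)
    (hq : ∀ x, HasDerivAt q ((k ^ 2 - c * (u x ^ 2 + v x ^ 2)) * v x) x)
    (hu0 : Tendsto u atTop (𝓝 0)) (hv0 : Tendsto v atTop (𝓝 0))
    (hne : ∃ x, u x ^ 2 + v x ^ 2 ≠ 0) :
    ∃ a b y : ℝ, c * (a ^ 2 + b ^ 2) = 2 * k ^ 2 ∧
      ∀ x, u x * cosh (k * (x + y)) = a ∧ v x * cosh (k * (x + y)) = b := by
  have hr0 : Tendsto (fun x => u x ^ 2 + v x ^ 2) atTop (𝓝 0) := by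
    simpa using (hu0.pow 2).add (hv0.pow 2)
  have hg0 : Tendsto (fun x => k ^ 2 - c * (u x ^ 2 + v x ^ 2)) atTop (𝓝 (k ^ 2)) := by
    simpa using (hr0.const_mul c).const_sub (k ^ 2)
  have hp0 : Tendsto p atTop (𝓝 0) :=
    tendsto_deriv_zero_of_tendsto_zero hu hp hu0 (by simpa using hg0.mul hu0)
  have hq0 : Tendsto q atTop (𝓝 0) :=
    tendsto_deriv_zero_of_tendsto_zero hv hq hv0 (by simpa using hg0.mul hv0)
  have hr : ∀ x, HasDerivAt (fun x => u x ^ 2 + v x ^ 2) (2 * (u x * p x + v x * q x)) x := by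
    intro x
    refine HasDerivAt.congr_deriv (((hu x).pow 2).add ((hv x).pow 2)) ?_
    simp; ring
  have hmom : ∀ x, u x * q x - v x * p x = 0 := by
    refine eq_zero_of_hasDerivAt_zero_of_tendsto (fun x => ?_)
      (by simpa using (hu0.mul hq0).sub (hv0.mul hp0))
    refine HasDerivAt.congr_deriv (((hu x).mul (hq x)).sub ((hv x).mul (hp x))) ?_
    ring
  have hen : ∀ x, p x ^ 2 + q x ^ 2 - k ^ 2 * (u x ^ 2 + v x ^ 2)
      + c / 2 * (u x ^ 2 + v x ^ 2) ^ 2 = 0 := by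
    refine eq_zero_of_hasDerivAt_zero_of_tendsto (fun x => ?_)
      (by
        simpa using (((hp0.pow 2).add (hq0.pow 2)).sub (hr0.const_mul (k ^ 2))).add
          ((hr0.pow 2).const_mul (c / 2)))
    refine HasDerivAt.congr_deriv (((((hp x).pow 2).add ((hq x).pow 2)).sub ((hr x).const_mul (k ^ 2))).add
        (((hr x).pow 2).const_mul (c / 2))) ?_
    simp; ring
  have hpos : ∀ x, 0 < u x ^ 2 + v x ^ 2 := by
    intro x
    refine lt_of_le_of_ne (by positivity) fun h => ?_
    obtain ⟨z, hz⟩ := hne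
    refine hz (eq_zero_of_abs_deriv_le (k := 2 * k) hr (fun x => by positivity)
      (fun x => ?_) h.symm z)
    refine abs_le_of_sq_le_sq ?_ (by positivity)
    have h1 : (u x * p x + v x * q x) ^ 2 = (u x ^ 2 + v x ^ 2) * (p x ^ 2 + q x ^ 2) := by
      linear_combination (-(u x * q x - v x * p x)) * hmom x
    have h2 : p x ^ 2 + q x ^ 2 ≤ k ^ 2 * (u x ^ 2 + v x ^ 2) := by
      have : 0 ≤ c / 2 * (u x ^ 2 + v x ^ 2) ^ 2 := by positivity
      linarith [hen x]
    have h3 := mul_le_mul_of_nonneg_left h2 (show 0 ≤ u x ^ 2 + v x ^ 2 by positivity)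
    rw [← h1] at h3
    linarith
  set w : ℝ → ℝ := fun x => (u x * p x + v x * q x) / (u x ^ 2 + v x ^ 2)
  have hwr : ∀ x, w x * (u x ^ 2 + v x ^ 2) = u x * p x + v x * q x := fun x =>
    div_mul_cancel₀ _ (hpos x).ne'
  have hpw : ∀ x, p x = w x * u x := fun x => by
    apply mul_right_cancel₀ (hpos x).ne'
    linear_combination (-u x) * hwr x - v x * hmom x
  have hqw : ∀ x, q x = w x * v x := fun x => by
    apply mul_right_cancel₀ (hpos x).ne'
    linear_combination (-v x) * hwr x + u x * hmom x
  have hw2 : ∀ x, w x ^ 2 = k ^ 2 - c / 2 * (u x ^ 2 + v x ^ 2) := fun x => by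
    have := hen x
    rw [hpw, hqw] at this
    apply mul_right_cancel₀ (hpos x).ne'
    linear_combination this
  have hw : ∀ x, HasDerivAt w (w x ^ 2 - k ^ 2) x := by
    intro x
    refine HasDerivAt.congr_deriv ((((hu x).mul (hp x)).add ((hv x).mul (hq x))).div (hr x) (hpos x).ne') ?_
    rw [div_eq_iff (pow_ne_zero 2 (hpos x).ne')]
    simp only [Pi.add_apply, Pi.mul_apply]
    rw [hpw, hqw]
    linear_combination (-2 * (u x ^ 2 + v x ^ 2) ^ 2) * hw2 x
  obtain ⟨y, hy⟩ := exists_shift_of_riccati hk hw fun x =>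
    abs_lt_of_sq_lt_sq (by rw [hw2]; linarith [mul_pos (half_pos hc) (hpos x)]) hk.le
  refine ⟨u (-y), v (-y), y, ?_, fun x =>
    ⟨mul_cosh_eq_of_hasDerivAt (fun x => hpw x ▸ hu x) hy x,
      mul_cosh_eq_of_hasDerivAt (fun x => hqw x ▸ hv x) hy x⟩⟩
  have h0 : w (-y) = 0 := by simpa using hy (-y)
  have := hw2 (-y)
  rw [h0] at this
  linear_combination 2 * this

/-- Polar form of a complex number, with argument in `[0, 2π)`. -/
theorem exists_mem_Ico_eq_exp_mul (z : ℂ) :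
    ∃ ω ∈ Set.Ico (0 : ℝ) (2 * π), z = Complex.exp (Complex.I * ω) * (‖z‖ : ℝ) := by
  refine ⟨toIcoMod two_pi_pos 0 z.arg, by simpa using toIcoMod_mem_Ico two_pi_pos 0 z.arg, ?_⟩
  have h : Complex.exp (Complex.I * (toIcoMod two_pi_pos 0 z.arg : ℝ))
      = Complex.exp (z.arg * Complex.I) := by
    rw [Complex.exp_eq_exp_iff_exists_int]
    refine ⟨-toIcoDiv two_pi_pos 0 z.arg, ?_⟩
    rw [toIcoMod]
    push_cast [zsmul_eq_mul]
    ring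
  rw [h, mul_comm, Complex.norm_mul_exp_arg_mul_I]

/-- With `B = A₃/2 + A₄ < 0`, `A₂ > 0`, `α > 0` and
`ν_NLS = −(9α²/(8A₂))B²`: every not-identically-zero C² solution `φ : ℝ → ℂ` of
`−(A₂/4)φ'' − 2ν_NLS φ + (3/2)B|φ|²φ = 0` with `φ(x) → 0` as `x → ±∞` is of the form
`φ(x) = e^{iω} φ_NLS(x + y)` for some `ω ∈ [0, 2π)` and `y ∈ ℝ`. -/
theorem NLS_solution_classification (A2 A3 A4 α : ℝ) (hA2 : 0 < A2) (hα : 0 < α)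
    (hB : A3 / 2 + A4 < 0) (φ : ℝ → ℂ) (hreg : ContDiff ℝ 2 φ)
    (hODE : ∀ x : ℝ,
      -((A2 : ℂ) / 4) * deriv (deriv φ) x
        - 2 * ((-(9 * α ^ 2 / (8 * A2)) * (A3 / 2 + A4) ^ 2 : ℝ) : ℂ) * φ x
        + (3 / 2) * ((A3 / 2 + A4 : ℝ) : ℂ) * ((Complex.normSq (φ x) : ℝ) : ℂ) * φ x = 0)
    (hdecay_top : Filter.Tendsto φ Filter.atTop (nhds 0))
    (hdecay_bot : Filter.Tendsto φ Filter.atBot (nhds 0))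
    (hne : φ ≠ 0) :
    ∃ ω ∈ Set.Ico (0:ℝ) (2 * π), ∃ y : ℝ, ∀ x : ℝ,
      φ x = Complex.exp (Complex.I * ω) * ((phiNLS A2 (A3 / 2 + A4) α (x + y) : ℝ) : ℂ) := by
  set B := A3 / 2 + A4 with hBdef
  have hk : 0 < -(3 * α * B / A2) := by
    rw [neg_pos]
    exact div_neg_of_neg_of_pos (by nlinarith) hA2
  have hc : 0 < -6 * B / A2 := div_pos (by linarith) hA2
  set k := -(3 * α * B / A2) with hkdef
  set c := -6 * B / A2 with hcdef
  have hd1 : ∀ x, HasDerivAt φ (deriv φ x) x := fun x =>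
    (hreg.differentiable (by norm_num) x).hasDerivAt
  have hd2 : ∀ x, HasDerivAt (deriv φ) (deriv (deriv φ) x) x := fun x =>
    ((contDiff_succ_iff_deriv.1 (show ContDiff ℝ (1 + 1) φ from by
      simpa [one_add_one_eq_two] using hreg)).2.2.differentiable (by norm_num) x).hasDerivAt
  have hA2_ne : (A2 : ℂ) ≠ 0 := by exact_mod_cast hA2.ne'
  have hode : ∀ x, deriv (deriv φ) x
      = ((k ^ 2 - c * ((φ x).re ^ 2 + (φ x).im ^ 2) : ℝ) : ℂ) * φ x := by
    intro x
    have h := hODE x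
    rw [Complex.normSq_apply] at h
    rw [hkdef, hcdef]
    push_cast at h ⊢
    field_simp at h ⊢
    linear_combination (-1 / 16 : ℂ) * h
  have hre : ∀ {f : ℝ → ℂ} {f₁ : ℂ} {x : ℝ}, HasDerivAt f f₁ x →
      HasDerivAt (fun x => (f x).re) f₁.re x := fun h =>
    Complex.reCLM.hasFDerivAt.comp_hasDerivAt _ h
  have him : ∀ {f : ℝ → ℂ} {f₁ : ℂ} {x : ℝ}, HasDerivAt f f₁ x →
      HasDerivAt (fun x => (f x).im) f₁.im x := fun h =>
    Complex.imCLM.hasFDerivAt.comp_hasDerivAt _ h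
  obtain ⟨a, b, y, hab, hsol⟩ := exists_sech_of_planar_ode
    (u := fun x => (φ x).re) (v := fun x => (φ x).im) hk hc
    (fun x => hre (hd1 x)) (fun x => him (hd1 x))
    (fun x => by
      have h := hre (hd2 x)
      rwa [hode, Complex.re_ofReal_mul] at h)
    (fun x => by
      have h := him (hd2 x)
      rwa [hode, Complex.im_ofReal_mul] at h)
    ((Complex.continuous_re.tendsto 0).comp hdecay_top)
    ((Complex.continuous_im.tendsto 0).comp hdecay_top)
    (by
      obtain ⟨x, hx⟩ := Function.ne_iff.1 hne
      refine ⟨x, fun h => hx (Complex.normSq_eq_zero.1 ?_)⟩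
      rw [Complex.normSq_apply]
      linarith)
  obtain ⟨ω, hω, hz⟩ := exists_mem_Ico_eq_exp_mul ⟨a, b⟩
  have hnorm : ‖(⟨a, b⟩ : ℂ)‖ = α * √(-3 * B / A2) := by
    have hs : 0 ≤ -3 * B / A2 := div_nonneg (by linarith) hA2.le
    rw [← sq_eq_sq₀ (norm_nonneg _) (by positivity), ← Complex.normSq_eq_norm_sq,
      Complex.normSq_mk, mul_pow, Real.sq_sqrt hs]
    apply mul_left_cancel₀ hc.ne'
    have h : c * (a * a + b * b) = 2 * k ^ 2 := by linear_combination hab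
    rw [h, hkdef, hcdef]
    ring
  refine ⟨ω, hω, y, fun x => ?_⟩
  have hcosh : ((cosh (k * (x + y)) : ℝ) : ℂ) ≠ 0 := by exact_mod_cast (cosh_pos _).ne'
  have hφ : φ x * ((cosh (k * (x + y)) : ℝ) : ℂ) = ⟨a, b⟩ :=
    Complex.ext (by simpa only [Complex.re_mul_ofReal] using (hsol x).1)
      (by simpa only [Complex.im_mul_ofReal] using (hsol x).2)
  rw [phiNLS, ← hkdef, ← hnorm, Complex.ofReal_mul, ← mul_assoc, ← hz, ← hφ,
    Complex.ofReal_div, Complex.ofReal_one, mul_one_div, mul_div_cancel_right₀ _ hcosh]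
end
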